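/- arXiv:math/0502432 — 5 statements merged into one kernel-verified Lean document; each statement's English description precedes it below -/
import Mathlib

section
/- For every integer n ≥ 1, the number of S-paths of n+1 coordinates, i.e., sequences S = (S_0, S_1, …, S_n) of natural numbers satisfying S_0 = 0, S_n = n, S_j ≤ j for 1 ≤ j ≤ n−1, and S_j ≤ S_{j+1} for 0 ≤ j ≤ n−1, equals the n-th Catalan number C_n (e.g., 1, 5, 42, 429, 16796 paths for n = 1, 3, 5, 7, 10 respectively). -/
/-- An S-path of `n+1` coordinates: a sequence `S = (S_0, …, S_n)` of natural numbers
with `S_0 = 0`, `S_n = n`, `S_j ≤ j` for `j ≤ n-1`, and `S_j ≤ S_{j+1}` for `j ≤ n-1`. -/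
def IsSPath (n : ℕ) (S : ℕ → ℕ) : Prop :=
  S 0 = 0 ∧ S n = n ∧ (∀ j < n, S j ≤ j) ∧ ∀ j < n, S j ≤ S (j + 1)

/-- The S-paths of `n + 1` coordinates, extended by the value `n`. -/
def spathSet (n : ℕ) : Set (ℕ → ℕ) := {S | IsSPath n S ∧ ∀ j, n ≤ j → S j = n}

/-- The sequence that starts at `0`, runs through `A` up to coordinate `i`, meets the diagonal at
coordinate `i + 1`, and continues from there as a translate of `B`. -/
def glueSPath (i : ℕ) (A B : ℕ → ℕ) (j : ℕ) : ℕ :=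
  if j = 0 then 0 else if j ≤ i then A (j - 1) else B (j - (i + 1)) + (i + 1)

theorem spathSet_zero : spathSet 0 = {fun _ => 0} := by
  ext S
  simp only [spathSet, IsSPath, Set.mem_ofPred_eq, Set.mem_singleton_iff]
  refine ⟨fun h => funext fun j => h.2 j j.zero_le, ?_⟩
  rintro rfl
  simp

theorem glueSPath_mem {n i : ℕ} (hi : i ≤ n) {A B : ℕ → ℕ} (hA : A ∈ spathSet i)
    (hB : B ∈ spathSet (n - i)) : glueSPath i A B ∈ spathSet (n + 1) := by
  obtain ⟨⟨-, -, hAle, hAmono⟩, hAi⟩ := hA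
  obtain ⟨⟨hB0, -, hBle, hBmono⟩, hBn⟩ := hB
  have hlast : ∀ j, n + 1 ≤ j → glueSPath i A B j = n + 1 := by
    intro j hj
    have := hBn (j - (i + 1)) (by omega)
    simp only [glueSPath]
    split_ifs <;> omega
  refine ⟨⟨by simp [glueSPath], hlast _ le_rfl, fun j hj => ?_, fun j hj => ?_⟩, hlast⟩
  · simp only [glueSPath]
    split_ifs with h0 h1
    · omega
    · have := hAle (j - 1) (by omega)
      omega
    · have := hBle (j - (i + 1)) (by omega)
      omega
  · rcases Nat.eq_zero_or_pos j with rfl | h0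
    · simp [glueSPath]
    · rcases lt_trichotomy j i with h1 | rfl | h1
      · have := hAmono (j - 1) (by omega)
        rw [Nat.sub_add_cancel h0] at this
        simpa [glueSPath, h0.ne', h1.le, Nat.succ_le_of_lt h1] using this
      · have := hAle (j - 1) (by omega)
        have hj' : ¬ j + 1 ≤ j := by omega
        simp only [glueSPath, h0.ne', hj', le_refl, if_true, if_false, Nat.sub_self,
          Nat.succ_ne_zero, hB0]
        omega
      · have := hBmono (j - (i + 1)) (by omega)
        rw [show j - (i + 1) + 1 = j - i by omega] at this
        have hj' : ¬ j + 1 ≤ i := by omega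
        simp only [glueSPath, h0.ne', h1.not_ge, hj', if_false,
          Nat.succ_ne_zero, Nat.add_sub_add_right]
        omega

/-- A glued path meets the diagonal for the first time at coordinate `i + 1`. -/
theorem glueSPath_lt {i j : ℕ} {A B : ℕ → ℕ} (hA : A ∈ spathSet i) (h0 : 0 < j) (hj : j ≤ i) :
    glueSPath i A B j < j := by
  have := hA.1.2.2.1 (j - 1) (by omega)
  simp only [glueSPath, h0.ne', hj, if_true, if_false]
  omega

theorem glueSPath_succ {m i : ℕ} {A B : ℕ → ℕ} (hB : B ∈ spathSet m) :
    glueSPath i A B (i + 1) = i + 1 := by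
  simp [glueSPath, hB.1.1]

theorem glueSPath_index_le {m i i' : ℕ} {A B A' B' : ℕ → ℕ} (hB : B ∈ spathSet m)
    (hA' : A' ∈ spathSet i') (h : glueSPath i A B = glueSPath i' A' B') : i' ≤ i := by
  by_contra! hlt
  have h1 := glueSPath_lt (B := B') hA' i.succ_pos hlt
  rw [← h, Nat.succ_eq_add_one, glueSPath_succ hB] at h1
  exact lt_irrefl _ h1

theorem glueSPath_injective {i : ℕ} {A B A' B' : ℕ → ℕ} (hA : A ∈ spathSet i)
    (hA' : A' ∈ spathSet i) (h : glueSPath i A B = glueSPath i A' B') :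
    A = A' ∧ B = B' := by
  refine ⟨funext fun j => ?_, funext fun j => ?_⟩
  · rcases lt_or_ge j i with hj | hj
    · simpa [glueSPath, Nat.succ_le_of_lt hj] using congrFun h (j + 1)
    · rw [hA.2 j hj, hA'.2 j hj]
  · have hji : ¬ j + (i + 1) ≤ i := by omega
    simpa [glueSPath, hji] using congrFun h (j + (i + 1))

theorem exists_glueSPath_eq {n : ℕ} {S : ℕ → ℕ} (hS : S ∈ spathSet (n + 1)) :
    ∃ i ≤ n, ∃ A ∈ spathSet i, ∃ B ∈ spathSet (n - i), glueSPath i A B = S := by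
  obtain ⟨⟨hS0, hSn, hSle, hSmono⟩, hS'⟩ := hS
  have hex : ∃ i, S (i + 1) = i + 1 := ⟨n, hSn⟩
  obtain ⟨i, hi, hmin⟩ : ∃ i, S (i + 1) = i + 1 ∧ ∀ j < i, S (j + 1) ≠ j + 1 :=
    ⟨Nat.find hex, Nat.find_spec hex, fun j hj => Nat.find_min hex hj⟩
  have hin : i ≤ n := by
    by_contra! h
    exact hmin n h hSn
  have hlt : ∀ j < i, S (j + 1) ≤ j := by
    intro j hj
    have := hmin j hj
    have := hSle (j + 1) (by omega)
    omega
  have hmono : Monotone S := monotone_nat_of_le_succ fun j => by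
    rcases lt_or_ge j (n + 1) with hj | hj
    · exact hSmono j hj
    · rw [hS' j hj, hS' (j + 1) (by omega)]
  have hge : ∀ j, i + 1 ≤ S (j + (i + 1)) := fun j => hi.symm.le.trans (hmono (by omega))
  refine ⟨i, hin, fun j => if j < i then S (j + 1) else i, ?_,
    fun j => S (j + (i + 1)) - (i + 1), ?_, ?_⟩
  · refine ⟨⟨?_, by simp, fun j hj => ?_, fun j hj => ?_⟩, fun j hj => by simp [hj.not_gt]⟩
    · rcases Nat.eq_zero_or_pos i with rfl | h
      · simp
      · simpa [h] using hlt 0 h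
    · simpa [hj] using hlt j hj
    · have := hlt j hj
      have := hmono (Nat.le_succ (j + 1))
      simp only [hj, if_true]
      split_ifs <;> omega
  · have hlast : ∀ j, n - i ≤ j → S (j + (i + 1)) - (i + 1) = n - i := by
      intro j hj
      have := hS' (j + (i + 1)) (by omega)
      omega
    refine ⟨⟨by simp [hi], hlast _ le_rfl, fun j hj => ?_, fun j hj => ?_⟩, hlast⟩
    · exact Nat.sub_le_of_le_add (hSle (j + (i + 1)) (by omega))
    · exact Nat.sub_le_sub_right (hmono (by omega)) _
  · funext j
    simp only [glueSPath]
    split_ifs with h0 h1 h2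
    · rw [h0, hS0]
    · rw [Nat.sub_add_cancel (by omega)]
    · omega
    · have := hge (j - (i + 1))
      rw [Nat.sub_add_cancel (by omega : i + 1 ≤ j)] at this ⊢
      omega

/-- The first-return decomposition of S-paths. -/
noncomputable def spathSetSuccEquiv (n : ℕ) :
    (Σ i : Fin (n + 1), spathSet i × spathSet (n - i)) ≃ spathSet (n + 1) :=
  Equiv.ofBijective
    (fun x => ⟨glueSPath x.1 x.2.1 x.2.2,
      glueSPath_mem (Nat.le_of_lt_succ x.1.2) x.2.1.2 x.2.2.2⟩) <| by
    constructor
    · rintro ⟨i, ⟨A, hA⟩, ⟨B, hB⟩⟩ ⟨i', ⟨A', hA'⟩, ⟨B', hB'⟩⟩ h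
      have h' : glueSPath i A B = glueSPath i' A' B' := congrArg Subtype.val h
      obtain rfl : i = i' := Fin.ext <|
        (glueSPath_index_le hB' hA h'.symm).antisymm (glueSPath_index_le hB hA' h')
      obtain ⟨rfl, rfl⟩ := glueSPath_injective hA hA' h'
      rfl
    · rintro ⟨S, hS⟩
      obtain ⟨i, hi, A, hA, B, hB, rfl⟩ := exists_glueSPath_eq hS
      exact ⟨⟨⟨i, Nat.lt_succ_of_le hi⟩, ⟨A, hA⟩, ⟨B, hB⟩⟩, rfl⟩

theorem finite_spathSet (n : ℕ) : Finite (spathSet n) := by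
  induction n using Nat.strong_induction_on with
  | _ n ih =>
    cases n with
    | zero => rw [spathSet_zero]; infer_instance
    | succ n =>
      have (i : Fin (n + 1)) : Finite (spathSet i) := ih i i.2
      have (i : Fin (n + 1)) : Finite (spathSet (n - i)) := ih (n - i) (by omega)
      exact Finite.of_equiv _ (spathSetSuccEquiv n)

theorem ncard_spathSet (n : ℕ) : (spathSet n).ncard = catalan n := by
  induction n using Nat.strong_induction_on with
  | _ n ih =>
    cases n with
    | zero => rw [spathSet_zero, Set.ncard_singleton, catalan_zero]
    | succ n =>
      have := finite_spathSet
      rw [← Nat.card_coe_set_eq, ← Nat.card_congr (spathSetSuccEquiv n), Nat.card_sigma,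
        catalan_succ]
      refine Finset.sum_congr rfl fun i _ => ?_
      rw [Nat.card_prod, Nat.card_coe_set_eq, Nat.card_coe_set_eq, ih i i.2,
        ih (n - i) (by omega)]

/-- For every integer `n ≥ 1`, the number of S-paths of `n+1` coordinates (encoded as
functions `ℕ → ℕ` pinned to the value `n` beyond coordinate `n`) equals the `n`-th
Catalan number. -/
theorem count_spaths_eq_catalan (n : ℕ) (hn : 1 ≤ n) :
    {S : ℕ → ℕ | IsSPath n S ∧ ∀ j, n ≤ j → S j = n}.ncard = catalan n :=
  ncard_spathSet n
end

section
/- Let n ≥ 1 and let p be a partition of {1, …, n}. Define S(p)_0 = 0 and, for 1 ≤ j ≤ n, S(p)_j = Σ_{C ∈ p, max C ≤ j} |C|. Then S(p) is an S-path of n+1 coordinates, the partition p corresponds to the path S(p), and the map p ↦ S(p) is a surjection from the set of all partitions of {1, …, n} onto the set of all S-paths of n+1 coordinates. -/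
/-- A partition `p` of `{1,…,n}` corresponds to the S-path `S` if for every
`j ∈ {1,…,n}`: `j` is the maximal element of some cell of `p` iff `m_j = S_j - S_{j-1} > 0`,
and in that case the cell with maximal element `j` has exactly `m_j` elements. -/
def Corresponds (n : ℕ) (p : Finpartition (Finset.Icc 1 n)) (S : ℕ → ℕ) : Prop :=
  ∀ j ∈ Finset.Icc 1 n,
    ((∃ C ∈ p.parts, C.sup id = j) ↔ S (j - 1) < S j) ∧
    ∀ C ∈ p.parts, C.sup id = j → C.card = S j - S (j - 1)

/-- The path associated to a partition `p` of `{1,…,n}`: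
`S(p)_j = Σ_{C ∈ p, max C ≤ j} |C|` (and `S(p)_0 = 0`). -/
def pathOf (n : ℕ) (p : Finpartition (Finset.Icc 1 n)) : ℕ → ℕ :=
  fun j => ∑ C ∈ p.parts.filter (fun C => C.sup id ≤ j), C.card

theorem Finset.sup_id_mem {C : Finset ℕ} (hC : C.Nonempty) : C.sup id ∈ C := by
  obtain ⟨i, hi, h⟩ := C.exists_mem_eq_sup hC id
  rw [h]
  exact hi

theorem pathOf_le {n : ℕ} (p : Finpartition (Finset.Icc 1 n)) (j : ℕ) : pathOf n p j ≤ j := by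
  have hd : ((p.parts.filter fun C => C.sup id ≤ j : Finset (Finset ℕ)) :
      Set (Finset ℕ)).PairwiseDisjoint id :=
    p.disjoint.subset (Finset.coe_subset.2 (Finset.filter_subset _ _))
  have hsub : (p.parts.filter fun C => C.sup id ≤ j).biUnion id ⊆ Finset.Icc 1 j := by
    intro x hx
    obtain ⟨C, hC, hxC⟩ := Finset.mem_biUnion.1 hx
    obtain ⟨hCp, hCj⟩ := Finset.mem_filter.1 hC
    exact Finset.mem_Icc.2 ⟨(Finset.mem_Icc.1 (p.le hCp hxC)).1,
      (Finset.le_sup (f := id) hxC).trans hCj⟩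
  calc pathOf n p j = ((p.parts.filter fun C => C.sup id ≤ j).biUnion id).card :=
        (Finset.card_biUnion hd).symm
    _ ≤ (Finset.Icc 1 j).card := Finset.card_le_card hsub
    _ = j := by simp

theorem pathOf_self {n : ℕ} (p : Finpartition (Finset.Icc 1 n)) : pathOf n p n = n := by
  have h : p.parts.filter (fun C => C.sup id ≤ n) = p.parts :=
    Finset.filter_true_of_mem fun C hC =>
      Finset.sup_le fun x hx => (Finset.mem_Icc.1 (p.le hC hx)).2
  simp only [pathOf]
  rw [h, p.sum_card_parts, Nat.card_Icc, Nat.add_sub_cancel]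

theorem pathOf_succ {n : ℕ} (p : Finpartition (Finset.Icc 1 n)) (j : ℕ) :
    pathOf n p (j + 1) =
      pathOf n p j + ∑ C ∈ p.parts.filter (fun C => C.sup id = j + 1), C.card := by
  have h : p.parts.filter (fun C => C.sup id ≤ j + 1) =
      p.parts.filter (fun C => C.sup id ≤ j) ∪ p.parts.filter (fun C => C.sup id = j + 1) := by
    rw [← Finset.filter_or]
    exact Finset.filter_congr fun C _ => Nat.le_succ_iff
  have hd : Disjoint (p.parts.filter fun C => C.sup id ≤ j)
      (p.parts.filter fun C => C.sup id = j + 1) :=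
    Finset.disjoint_filter.2 fun C _ h₁ h₂ => by omega
  simp only [pathOf]
  rw [h, Finset.sum_union hd]

theorem pathOf_succ_eq_add_card {n j : ℕ} {p : Finpartition (Finset.Icc 1 n)} {C : Finset ℕ}
    (hC : C ∈ p.parts) (hj : C.sup id = j + 1) :
    pathOf n p (j + 1) = pathOf n p j + C.card := by
  have h : p.parts.filter (fun D => D.sup id = j + 1) = {C} := by
    ext D
    simp only [Finset.mem_filter, Finset.mem_singleton]
    refine ⟨fun ⟨hD, hDj⟩ => ?_, fun h => h ▸ ⟨hC, hj⟩⟩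
    have hDm := Finset.sup_id_mem (p.nonempty_of_mem_parts hD)
    have hCm := Finset.sup_id_mem (p.nonempty_of_mem_parts hC)
    rw [hDj] at hDm
    rw [hj] at hCm
    exact p.eq_of_mem_parts hD hC hDm hCm
  rw [pathOf_succ, h, Finset.sum_singleton]

theorem isSPath_pathOf {n : ℕ} (p : Finpartition (Finset.Icc 1 n)) : IsSPath n (pathOf n p) :=
  ⟨Nat.le_zero.1 (pathOf_le p 0), pathOf_self p, fun j _ => pathOf_le p j,
    fun j _ => pathOf_succ p j ▸ Nat.le_add_right _ _⟩

theorem corresponds_pathOf {n : ℕ} (p : Finpartition (Finset.Icc 1 n)) :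
    Corresponds n p (pathOf n p) := by
  intro j hj
  obtain ⟨i, rfl⟩ := Nat.exists_eq_add_of_le' (Finset.mem_Icc.1 hj).1
  simp only [Nat.add_sub_cancel]
  refine ⟨⟨fun ⟨C, hC, hCi⟩ => ?_, fun h => ?_⟩, fun C hC hCi => ?_⟩
  · have := (p.nonempty_of_mem_parts hC).card_pos
    rw [pathOf_succ_eq_add_card hC hCi]
    omega
  · by_contra! hne
    rw [pathOf_succ, Finset.filter_false_of_mem hne] at h
    simp at h
  · rw [pathOf_succ_eq_add_card hC hCi]
    omega

/-- A monotone sequence with `S 0 = 0` and `S j ≤ j` up to `k` is realised by a partition of a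
subset of `{1,…,k}`. -/
theorem exists_finpartition_subset_Icc (S : ℕ → ℕ) (h0 : S 0 = 0) (k : ℕ)
    (hle : ∀ j ≤ k, S j ≤ j) (hmono : ∀ j < k, S j ≤ S (j + 1)) :
    ∃ U ⊆ Finset.Icc 1 k, ∃ p : Finpartition U,
      ∀ j ≤ k, ∑ C ∈ p.parts.filter (fun C => C.sup id ≤ j), C.card = S j := by
  induction k with
  | zero =>
    refine ⟨∅, by simp, Finpartition.empty _, fun j hj => ?_⟩
    rw [Nat.le_zero.1 hj, h0]
    rfl
  | succ k ih =>
    obtain ⟨U, hU, p, hp⟩ := ih (fun j hj => hle j (by omega)) fun j hj => hmono j (by omega)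
    have hsup : ∀ C ∈ p.parts, C.sup id ≤ k := fun C hC =>
      Finset.sup_le fun x hx => (Finset.mem_Icc.1 (hU (p.le hC hx))).2
    have hfilter : ∀ j, k ≤ j → p.parts.filter (fun C => C.sup id ≤ j) = p.parts := fun j hj =>
      Finset.filter_true_of_mem fun C hC => (hsup C hC).trans hj
    have hUk : U.card = S k := by
      rw [← hp k le_rfl, hfilter k le_rfl, p.sum_card_parts]
    have hIcc : Finset.Icc 1 k ⊆ Finset.Icc 1 (k + 1) := Finset.Icc_subset_Icc_right (by omega)
    rcases (hmono k (by omega)).eq_or_lt with heq | hlt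
    · refine ⟨U, hU.trans hIcc, p, fun j hj => ?_⟩
      rcases Nat.le_add_one_iff.1 hj with hj | rfl
      · exact hp j hj
      · rw [hfilter _ (by omega), p.sum_card_parts, hUk, heq]
    · have hcard : S (k + 1) - S k - 1 ≤ (Finset.Icc 1 k \ U).card := by
        rw [Finset.card_sdiff_of_subset hU, hUk, Nat.card_Icc]
        have := hle (k + 1) le_rfl
        omega
      obtain ⟨T, hT, hTcard⟩ := Finset.exists_subset_card_eq hcard
      have hkT : k + 1 ∉ T := fun h => by
        have := Finset.mem_Icc.1 (Finset.mem_sdiff.1 (hT h)).1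
        omega
      have hkU : k + 1 ∉ U := fun h => by
        have := Finset.mem_Icc.1 (hU h)
        omega
      have hdisj : Disjoint U (insert (k + 1) T) :=
        Finset.disjoint_insert_right.2 ⟨hkU, (Finset.subset_sdiff.1 hT).2.symm⟩
      have hbcard : (insert (k + 1) T).card = S (k + 1) - S k := by
        rw [Finset.card_insert_of_notMem hkT, hTcard]
        omega
      have hTk : insert (k + 1) T ⊆ Finset.Icc 1 (k + 1) :=
        Finset.insert_subset (by simp) ((hT.trans Finset.sdiff_subset).trans hIcc)
      have hUnion : U ∪ insert (k + 1) T ⊆ Finset.Icc 1 (k + 1) :=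
        Finset.union_subset (hU.trans hIcc) hTk
      refine ⟨U ∪ insert (k + 1) T, hUnion,
        p.extend (Finset.insert_ne_empty _ _) hdisj rfl, fun j hj => ?_⟩
      rcases Nat.le_add_one_iff.1 hj with hj | rfl
      · have hb : ¬ (insert (k + 1) T).sup id ≤ j := fun h => by
          have := (Finset.le_sup (f := id) (Finset.mem_insert_self (k + 1) T)).trans h
          simp only [id] at this
          omega
        rw [Finpartition.extend_parts, Finset.filter_insert, if_neg hb, hp j hj]
      · rw [Finset.filter_true_of_mem, Finpartition.sum_card_parts,
          Finset.card_union_of_disjoint hdisj, hUk, hbcard]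
        · omega
        · exact fun C hC => Finset.sup_le fun x hx =>
            (Finset.mem_Icc.1 (hUnion (Finpartition.le _ hC hx))).2

theorem exists_pathOf_eq {n : ℕ} {S : ℕ → ℕ} (hS : IsSPath n S) :
    ∃ p : Finpartition (Finset.Icc 1 n), ∀ j ≤ n, pathOf n p j = S j := by
  obtain ⟨h0, hn, hle, hmono⟩ := hS
  obtain ⟨U, hU, p, hp⟩ := exists_finpartition_subset_Icc S h0 n
    (fun j hj => hj.lt_or_eq.elim (hle j) fun h => by rw [h, hn]) hmono
  have hcard : n ≤ U.card := by
    rw [← p.sum_card_parts]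
    calc n = _ := hn.symm.trans (hp n le_rfl).symm
      _ ≤ _ := Finset.sum_le_sum_of_subset (Finset.filter_subset _ _)
  obtain rfl : U = Finset.Icc 1 n := Finset.eq_of_subset_of_card_le hU (by simpa using hcard)
  exact ⟨p, hp⟩

/-- For every partition `p` of `{1,…,n}`, `S(p)` is an S-path of `n+1` coordinates to
which `p` corresponds, and `p ↦ S(p)` is a surjection onto the set of S-paths of
`n+1` coordinates. -/
theorem pathOf_is_spath_corresponds_surjective (n : ℕ) (hn : 1 ≤ n) :
    (∀ p : Finpartition (Finset.Icc 1 n),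
        IsSPath n (pathOf n p) ∧ Corresponds n p (pathOf n p)) ∧
    ∀ S : ℕ → ℕ, IsSPath n S →
      ∃ p : Finpartition (Finset.Icc 1 n), ∀ j ≤ n, pathOf n p j = S j := by
  exact ⟨fun p => ⟨isSPath_pathOf p, corresponds_pathOf p⟩, fun _ hS => exists_pathOf_eq hS⟩
end

section
/- For every integer n ≥ 1, the sum over all S-paths S of n+1 coordinates of the product, over all j ∈ {1, …, n} with m_j = S_j − S_{j−1} > 0, of binom(j − 1 − S_{j−1}, j − S_j), equals the total number of partitions of {1, …, n} (the n-th Bell number). -/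
section SPathSum

open Finset

namespace Finpartition

variable {α : Type*} [DecidableEq α] {s : Finset α} {a : α}

/-- Add a new element `a` to the part `B` of a partition of `s`, or as a new singleton part
if `B = ∅`. -/
def insertInto (P : Finpartition s) (ha : a ∉ s) {B : Finset α} (hB : B ∈ insert ∅ P.parts) :
    Finpartition (insert a s) :=
  ofExistsUnique (insert (insert a B) (P.parts.erase B))
    (by
      have := fun p (hp : p ∈ P.parts) => P.subset hp
      intro p hp
      simp only [mem_insert, mem_erase] at hp hB
      grind)
    (by
      have h1 := fun p (hp : p ∈ P.parts) => P.subset hp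
      intro x hx
      rw [mem_insert] at hx
      by_cases hxB : x = a ∨ x ∈ B
      · refine ⟨insert a B, by simpa using hxB, ?_⟩
        rintro p ⟨hp, hxp⟩
        simp only [mem_insert, mem_erase] at hp hB
        rcases hp with hp | ⟨hpB, hp⟩
        · exact hp
        · rcases hxB with rfl | hxB
          · exact absurd (h1 p hp hxp) ha
          · rcases hB with rfl | hB
            · simp at hxB
            · exact absurd (P.eq_of_mem_parts hp hB hxp hxB) hpB
      · have hxs : x ∈ s := by tauto
        obtain ⟨p, ⟨hp, hxp⟩, huniq⟩ := P.existsUnique_mem hxs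
        refine ⟨p, ⟨?_, hxp⟩, ?_⟩
        · simp only [mem_insert, mem_erase]
          grind
        · rintro q ⟨hq, hxq⟩
          simp only [mem_insert, mem_erase] at hq
          grind)
    (by
      rw [mem_insert, mem_erase, not_or]
      exact ⟨(insert_ne_empty a B).symm, fun h => P.empty_notMem_parts h.2⟩)

theorem parts_insertInto (P : Finpartition s) (ha : a ∉ s) {B : Finset α}
    (hB : B ∈ insert ∅ P.parts) :
    (P.insertInto ha hB).parts = insert (insert a B) (P.parts.erase B) := rfl

theorem card_parts_insertInto (P : Finpartition s) (ha : a ∉ s) {B : Finset α}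
    (hB : B ∈ insert ∅ P.parts) :
    #(P.insertInto ha hB).parts = if B = ∅ then #P.parts + 1 else #P.parts := by
  have h1 := fun p (hp : p ∈ P.parts) => P.subset hp
  have h2 := P.empty_notMem_parts
  rw [parts_insertInto, card_insert_of_notMem]
  · split_ifs with h
    · subst h
      rw [erase_eq_of_notMem h2]
    · exact card_erase_add_one (by simpa [h] using hB)
  · intro h
    exact ha (h1 _ (mem_of_mem_erase h) (mem_insert_self a B))

theorem insertInto_injective {P P' : Finpartition s} (ha : a ∉ s) {B B' : Finset α}
    (hB : B ∈ insert ∅ P.parts) (hB' : B' ∈ insert ∅ P'.parts)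
    (h : P.insertInto ha hB = P'.insertInto ha hB') : P = P' ∧ B = B' := by
  have h1 := fun p (hp : p ∈ P.parts) hap => ha (P.subset hp hap)
  have h1' := fun p (hp : p ∈ P'.parts) hap => ha (P'.subset hp hap)
  have h2 := P.empty_notMem_parts
  have h2' := P'.empty_notMem_parts
  have hparts := congrArg Finpartition.parts h
  rw [parts_insertInto, parts_insertInto] at hparts
  have haB : a ∉ B := by rcases mem_insert.1 hB with rfl | h <;> grind
  have haB' : a ∉ B' := by rcases mem_insert.1 hB' with rfl | h <;> grind
  have hBB : insert a B = insert a B' := by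
    have : insert a B ∈ insert (insert a B') (P'.parts.erase B') :=
      hparts ▸ mem_insert_self _ _
    rcases mem_insert.1 this with h | h
    · exact h
    · exact absurd (mem_insert_self a B) (h1' _ (mem_of_mem_erase h))
  have hBeq : B = B' := by
    rw [← erase_insert haB, hBB, erase_insert haB']
  subst hBeq
  refine ⟨?_, rfl⟩
  have he : P.parts.erase B = P'.parts.erase B := by
    rw [← erase_insert (a := insert a B) (s := P.parts.erase B), hparts, erase_insert]
    · exact fun h => h1' _ (mem_of_mem_erase h) (mem_insert_self a B)
    · exact fun h => h1 _ (mem_of_mem_erase h) (mem_insert_self a B)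
  ext p
  by_cases hp : p = B
  · subst hp
    grind
  · have := congrArg (p ∈ ·) he
    simpa [hp] using this

theorem exists_insertInto_eq (ha : a ∉ s) (Q : Finpartition (insert a s)) :
    ∃ (P : Finpartition s) (B : Finset α) (hB : B ∈ insert ∅ P.parts),
      P.insertInto ha hB = Q := by
  have hs : insert a s \ {a} = s := by grind
  have haQ : a ∈ Q.part a := Q.mem_part_self.2 (mem_insert_self a s)
  have hQ : Q.part a ∈ Q.parts := Q.part_mem.2 (mem_insert_self a s)
  have hmem : ∀ p, p ∈ ((Q.avoid {a}).copy hs).parts ↔ p ≠ ∅ ∧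
      (p = Q.part a \ {a} ∨ p ∈ Q.parts ∧ a ∉ p) := by
    intro p
    change p ∈ (Q.avoid {a}).parts ↔ _
    rw [mem_avoid]
    constructor
    · rintro ⟨d, hd, hda, rfl⟩
      refine ⟨by simpa [sdiff_eq_empty_iff_subset] using hda, ?_⟩
      by_cases had : a ∈ d
      · left
        rw [Q.part_eq_of_mem hd had]
      · right
        rw [sdiff_singleton_eq_erase, erase_eq_of_notMem had]
        exact ⟨hd, had⟩
    · rintro ⟨hp, rfl | ⟨hp1, hp2⟩⟩
      · exact ⟨_, hQ, by simpa [sdiff_eq_empty_iff_subset] using hp, rfl⟩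
      · refine ⟨p, hp1, ?_, by rw [sdiff_singleton_eq_erase, erase_eq_of_notMem hp2]⟩
        intro h
        rcases subset_singleton_iff.1 h with h | h <;> simp_all
  have hB : Q.part a \ {a} ∈ insert ∅ ((Q.avoid {a}).copy hs).parts := by
    rw [mem_insert, hmem]
    tauto
  refine ⟨(Q.avoid {a}).copy hs, _, hB, ?_⟩
  ext p
  rw [parts_insertInto, mem_insert, mem_erase, hmem]
  have hins : insert a (Q.part a \ {a}) = Q.part a := by grind
  rw [hins]
  constructor
  · rintro (rfl | ⟨h1, h2, h3 | h3⟩)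
    · exact hQ
    · exact absurd h3 h1
    · exact h3.1
  · intro hp
    by_cases hap : a ∈ p
    · exact Or.inl (Q.part_eq_of_mem hp hap).symm
    · refine Or.inr ⟨?_, Q.ne_empty hp, Or.inr ⟨hp, hap⟩⟩
      intro h
      obtain ⟨x, hx⟩ := Q.nonempty_of_mem_parts hp
      have := Q.eq_of_mem_parts hp hQ hx (mem_sdiff.1 (h ▸ hx)).1
      exact hap (this ▸ haQ)

theorem sum_card_parts_insert {M : Type*} [AddCommMonoid M] (ha : a ∉ s) (f : ℕ → M) :
    ∑ Q : Finpartition (insert a s), f #Q.parts =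
      ∑ P : Finpartition s, (f (#P.parts + 1) + #P.parts • f #P.parts) := by
  have hsum : ∀ P : Finpartition s, f (#P.parts + 1) + #P.parts • f #P.parts =
      ∑ B ∈ insert ∅ P.parts, f (if B = ∅ then #P.parts + 1 else #P.parts) := by
    intro P
    rw [sum_insert P.empty_notMem_parts, if_pos rfl, ← sum_const]
    congr 1
    exact sum_congr rfl fun B hB => by rw [if_neg (P.ne_empty hB)]
  simp_rw [hsum]
  rw [sum_sigma']
  symm
  refine sum_bij (fun x hx => x.1.insertInto ha (mem_sigma.1 hx).2) (fun _ _ => mem_univ _)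
    ?_ ?_ ?_
  · rintro ⟨P, B⟩ hx ⟨P', B'⟩ hx' h
    obtain ⟨rfl, rfl⟩ := insertInto_injective ha _ _ h
    rfl
  · intro Q _
    obtain ⟨P, B, hB, h⟩ := exists_insertInto_eq ha Q
    exact ⟨⟨P, B⟩, mem_sigma.2 ⟨mem_univ _, hB⟩, h⟩
  · rintro ⟨P, B⟩ hx
    rw [card_parts_insertInto]

end Finpartition

/-- The number of ways to complete an S-path, counted with weights, when `m` steps remain and
`h` elements lie in blocks that are not yet closed. Equivalently, the number of pairs of
a partition of an `m`-element set and a map from an `h`-element set to its parts. -/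
def completions : ℕ → ℕ → ℕ
  | 0, h => 0 ^ h
  | m + 1, h => completions m (h + 1) + ∑ i ∈ range (h + 1), h.choose i * completions m i

theorem sum_card_parts_pow {α : Type*} [DecidableEq α] (s : Finset α) (h : ℕ) :
    ∑ P : Finpartition s, #P.parts ^ h = completions #s h := by
  induction s using Finset.induction_on generalizing h with
  | empty =>
    have : Unique (Finpartition (∅ : Finset α)) :=
      inferInstanceAs (Unique (Finpartition (⊥ : Finset α)))
    have hc : ∀ P : Finpartition (∅ : Finset α), #P.parts = 0 := fun P =>
      Nat.le_zero.1 P.card_parts_le_card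
    simp only [hc, card_empty, completions]
    rw [sum_const, card_univ, Fintype.card_unique, one_smul]
  | insert a s ha ih =>
    rw [Finpartition.sum_card_parts_insert ha (· ^ h), card_insert_of_notMem ha, completions,
      sum_add_distrib, add_comm]
    congr 1
    · rw [← ih]
      exact sum_congr rfl fun P _ => by rw [smul_eq_mul, pow_succ']
    · simp_rw [← ih, mul_sum]
      rw [sum_comm]
      refine sum_congr rfl fun P _ => ?_
      rw [add_pow]
      exact sum_congr rfl fun i _ => by simp [mul_comm]

theorem card_finpartition {α : Type*} [DecidableEq α] (s : Finset α) :
    Nat.card (Finpartition s) = completions #s 0 := by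
  rw [← sum_card_parts_pow, Nat.card_eq_fintype_card]
  simp

/-- The path which agrees with `S` up to coordinate `k` and is equal to `v` afterwards. -/
def extendPath (S : ℕ → ℕ) (k v : ℕ) : ℕ → ℕ := fun i => if i ≤ k then S i else v

open Classical in
/-- Weakly increasing paths below the diagonal, constant from coordinate `k` on. -/
noncomputable def pathPrefixes : ℕ → Finset (ℕ → ℕ)
  | 0 => {fun _ => 0}
  | k + 1 => ((pathPrefixes k).sigma fun S => Icc (S k) (k + 1)).image
      fun p => extendPath p.1 k p.2

theorem mem_pathPrefixes {k : ℕ} {S : ℕ → ℕ} :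
    S ∈ pathPrefixes k ↔ S 0 = 0 ∧ (∀ j ≤ k, S j ≤ j) ∧ (∀ j < k, S j ≤ S (j + 1)) ∧
      ∀ j, k ≤ j → S j = S k := by
  induction k generalizing S with
  | zero =>
    simp only [pathPrefixes, mem_singleton, funext_iff]
    grind
  | succ k ih =>
    simp only [pathPrefixes, mem_image, mem_sigma, Sigma.exists, ih, mem_Icc]
    constructor
    · rintro ⟨S, v, ⟨⟨h0, h1, h2, h3⟩, h4, h5⟩, rfl⟩
      simp only [extendPath]
      refine ⟨by simpa using h0, fun j hj => ?_, fun j hj => ?_, fun j hj => ?_⟩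
      · split_ifs with h
        · exact h1 j h
        · grind
      · have := h2 j
        grind
      · grind
    · rintro ⟨h0, h1, h2, h3⟩
      refine ⟨extendPath S k (S k), S (k + 1), ⟨⟨?_, ?_, ?_, ?_⟩, ?_, ?_⟩, ?_⟩
      · simpa [extendPath] using h0
      · intro j hj
        simpa [extendPath, hj] using h1 j (by omega)
      · intro j hj
        simpa [extendPath, hj.le, Nat.succ_le_of_lt hj] using h2 j (by omega)
      · intro j hj
        simp only [extendPath]
        grind
      · simpa [extendPath] using h2 k (by omega)
      · exact h1 _ le_rfl
      · funext i
        simp only [extendPath]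
        grind

open Classical in
theorem sum_pathPrefixes_succ {M : Type*} [AddCommMonoid M] (k : ℕ) (f : (ℕ → ℕ) → M) :
    ∑ S ∈ pathPrefixes (k + 1), f S =
      ∑ S ∈ pathPrefixes k, ∑ v ∈ Icc (S k) (k + 1), f (extendPath S k v) := by
  rw [pathPrefixes, sum_image, sum_sigma]
  rintro ⟨S, v⟩ hS ⟨S', v'⟩ hS' h
  simp only [coe_sigma, Set.mem_sigma_iff, mem_coe, mem_pathPrefixes] at hS hS'
  have h' : ∀ i, extendPath S k v i = extendPath S' k v' i := congrFun h
  simp only [extendPath] at h'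
  have hv : v = v' := by simpa using h' (k + 1)
  have hSS : S = S' := by
    funext i
    have hi := h' i
    have hk := h' k
    grind
  subst hv hSS
  rfl

/-- The weight of the first `k` steps of a path. -/
def pathWeight (k : ℕ) (S : ℕ → ℕ) : ℕ :=
  ∏ j ∈ (Icc 1 k).filter (fun j => S (j - 1) < S j), (j - 1 - S (j - 1)).choose (j - S j)

theorem pathWeight_extendPath (k v : ℕ) (S : ℕ → ℕ) :
    pathWeight (k + 1) (extendPath S k v) =
      pathWeight k S * if S k < v then (k - S k).choose (k + 1 - v) else 1 := by
  simp only [pathWeight, prod_filter]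
  rw [prod_Icc_succ_top (by omega)]
  congr 1
  · refine prod_congr rfl fun j hj => ?_
    rw [mem_Icc] at hj
    have hj' : j - 1 ≤ k := by omega
    simp [extendPath, hj.2, hj']
  · simp [extendPath]

theorem sum_step (k m c : ℕ) (hc : c ≤ k) :
    ∑ v ∈ Icc c (k + 1), (if c < v then (k - c).choose (k + 1 - v) else 1) *
      completions m (k + 1 - v) = completions (m + 1) (k - c) := by
  rw [completions, ← add_sum_Ioc_eq_sum_Icc (by omega), if_neg (lt_irrefl c), one_mul]
  congr 1
  · congr 1
    omega
  · refine sum_bij' (fun v _ => k + 1 - v) (fun i _ => k + 1 - i) ?_ ?_ ?_ ?_ ?_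
    all_goals intro v hv; simp only [mem_Ioc, mem_range] at hv ⊢
    · omega
    · omega
    · omega
    · omega
    · rw [if_pos hv.1]

theorem sum_pathWeight_mul_completions (k m : ℕ) :
    ∑ S ∈ pathPrefixes k, pathWeight k S * completions m (k - S k) = completions (m + k) 0 := by
  induction k generalizing m with
  | zero => simp [pathPrefixes, pathWeight]
  | succ k ih =>
    rw [sum_pathPrefixes_succ, show m + (k + 1) = m + 1 + k by omega, ← ih]
    refine sum_congr rfl fun S hS => ?_
    rw [← sum_step k m (S k) ((mem_pathPrefixes.1 hS).2.1 k le_rfl), mul_sum]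
    refine sum_congr rfl fun v _ => ?_
    rw [pathWeight_extendPath, mul_assoc]
    simp [extendPath]

end SPathSum

/-- The sum over all S-paths of `n+1` coordinates (encoded as functions `ℕ → ℕ` pinned
to `n` beyond coordinate `n`) of `∏_{j : m_j > 0} binom(j - 1 - S_{j-1}, j - S_j)`
equals the total number of partitions of `{1,…,n}` (the `n`-th Bell number). -/
theorem sum_over_spaths_eq_bell (n : ℕ) (hn : 1 ≤ n) :
    (∑ᶠ S ∈ {S : ℕ → ℕ | IsSPath n S ∧ ∀ j, n ≤ j → S j = n},
        ∏ j ∈ (Finset.Icc 1 n).filter (fun j => S (j - 1) < S j),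
          Nat.choose (j - 1 - S (j - 1)) (j - S j)) =
      Nat.card (Finpartition (Finset.Icc 1 n)) := by
  have hset : {S : ℕ → ℕ | IsSPath n S ∧ ∀ j, n ≤ j → S j = n} =
      ↑((pathPrefixes n).filter fun S => S n = n) := by
    ext S
    simp only [IsSPath, Set.mem_ofPred_eq, Finset.coe_filter, mem_pathPrefixes]
    constructor
    · rintro ⟨⟨h0, hn, h1, h2⟩, h3⟩
      refine ⟨⟨h0, fun j hj => ?_, h2, fun j hj => by rw [h3 j hj, hn]⟩, hn⟩
      rcases hj.lt_or_eq with hj | rfl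
      · exact h1 j hj
      · exact hn.le
    · rintro ⟨⟨h0, h1, h2, h3⟩, hn⟩
      exact ⟨⟨h0, hn, fun j hj => h1 j hj.le, h2⟩, fun j hj => by rw [h3 j hj, hn]⟩
  rw [hset, finsum_mem_coe_finset, card_finpartition, Nat.card_Icc, Nat.add_sub_cancel,
    ← zero_add n, ← sum_pathWeight_mul_completions n 0, zero_add, Finset.sum_filter]
  refine Finset.sum_congr rfl fun S hS => ?_
  have hle := (mem_pathPrefixes.1 hS).2.1 n le_rfl
  split_ifs with h
  · simp [h, completions, pathWeight]
  · rw [completions, zero_pow (by omega), mul_zero]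
end

section
/- Let n ≥ 2, let S = (S_0, …, S_n) be an S-path of n+1 coordinates, and let r ∈ {1, …, n−1}. Let q = min{ l : r < l ≤ n and S_l > S_r } (this minimum exists since S_r ≤ r < n = S_n). Then S_r = S_{r+1} = … = S_{q−1}, one has S_{r−1} ≤ min(r, S_q − 1), and for every integer j with S_{r−1} ≤ j ≤ min(r, S_q − 1), the vector S′ = (S_0, …, S_{r−1}, j, j, …, j, S_q, …, S_n), obtained from S by replacing the coordinates S_r, …, S_{q−1} all by j, is again a valid S-path of n+1 coordinates. -/
/-- Well-definedness of one step of the accelerated path sampler: with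
`q = min{l : r < l ≤ n, S_l > S_r}` (which exists), the path is flat between `r` and
`q`, `S_{r-1} ≤ min(r, S_q - 1)`, and replacing the coordinates `S_r, …, S_{q-1}` all
by any `j` with `S_{r-1} ≤ j ≤ min(r, S_q - 1)` yields again a valid S-path. -/
theorem ap_sampler_step_valid (n : ℕ) (hn : 2 ≤ n) (S : ℕ → ℕ) (hS : IsSPath n S)
    (r : ℕ) (hr1 : 1 ≤ r) (hr2 : r ≤ n - 1)
    (q : ℕ) (hq : q = sInf {l : ℕ | r < l ∧ l ≤ n ∧ S r < S l}) :
    (r < q ∧ q ≤ n ∧ S r < S q) ∧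
    (∀ k, r ≤ k → k < q → S k = S r) ∧
    S (r - 1) ≤ min r (S q - 1) ∧
    (∀ j, S (r - 1) ≤ j → j ≤ min r (S q - 1) →
      IsSPath n (fun k => if r ≤ k ∧ k < q then j else S k)) := by
  obtain ⟨h0, hn', hle, hmono⟩ := hS
  have hne : {l : ℕ | r < l ∧ l ≤ n ∧ S r < S l}.Nonempty :=
    ⟨n, by omega, le_rfl, by have := hle r (by omega); omega⟩
  have hmem : r < q ∧ q ≤ n ∧ S r < S q := hq ▸ Nat.sInf_mem hne
  obtain ⟨hrq, hqn, hSq⟩ := hmem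
  have hflat : ∀ k, r ≤ k → k < q → S k = S r := by
    intro k hrk
    induction k, hrk using Nat.le_induction with
    | base => exact fun _ => rfl
    | succ k hrk ih =>
      intro hkq
      have hk := ih (by omega)
      have hstep := hmono k (by omega)
      have hnot : ¬(r < k + 1 ∧ k + 1 ≤ n ∧ S r < S (k + 1)) :=
        Nat.notMem_of_lt_sInf (hq ▸ hkq)
      omega
  have hpred : S (r - 1) ≤ S r := by
    simpa [Nat.sub_add_cancel hr1] using hmono (r - 1) (by omega)
  have hr : S r ≤ r := hle r (by omega)
  refine ⟨⟨hrq, hqn, hSq⟩, hflat, by omega, fun j hj₁ hj₂ => ⟨?_, ?_, ?_, ?_⟩⟩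
  · simp [h0, show ¬ r ≤ 0 by omega]
  · simp [hn', show ¬ n < q by omega]
  · intro k hk
    have := hle k hk
    dsimp only
    split_ifs <;> omega
  · intro k hk
    have hstep := hmono k hk
    dsimp only
    split_ifs with h₁ h₂ h₂
    · exact le_rfl
    · obtain rfl : q = k + 1 := by omega
      omega
    · obtain rfl : k = r - 1 := by omega
      exact hj₁
    · exact hstep
end

section
/- Let n ≥ 2 and let S = (S_0, …, S_n) be any S-path of n+1 coordinates. Define a sequence of vectors by S^{(0)} = S and, for r = 1, …, n−1, let S^{(r)} be obtained from S^{(r−1)} by replacing its r-th coordinate by its (r−1)-th coordinate (i.e., S^{(r)}_r = S^{(r−1)}_{r−1}, all other coordinates unchanged). Then every S^{(r)} is a valid S-path of n+1 coordinates, and S^{(n−1)} = (0, 0, …, 0, n). Hence every S-path can be transformed into the path (0, 0, …, 0, n) within one cycle of single-coordinate moves, each move replacing S_r by a value in the admissible range {S_{r−1}, …, min(r, S_{r+1})}. -/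
/-- After `r` moves the coordinates up to `r` vanish and the others are unchanged. -/
theorem sweep_apply_eq_ite {n : ℕ} {S : ℕ → ℕ} (hS0 : S 0 = 0) {A : ℕ → ℕ → ℕ}
    (hA0 : A 0 = S)
    (hAstep : ∀ r, 1 ≤ r → r ≤ n - 1 →
      A r = Function.update (A (r - 1)) r (A (r - 1) (r - 1)))
    {r : ℕ} (hr : r ≤ n - 1) (k : ℕ) : A r k = if k ≤ r then 0 else S k := by
  induction r generalizing k with
  | zero =>
    rw [hA0]
    split_ifs with h
    · rw [Nat.le_zero.mp h, hS0]
    · rfl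
  | succ r ih =>
    have ih := ih (by omega)
    rw [hAstep (r + 1) (by omega) hr, Function.update_apply, Nat.add_sub_cancel, ih, ih]
    grind

/-- Replacing an initial segment of an S-path by zeros gives an S-path. -/
theorem IsSPath.of_eq_ite {n r : ℕ} {S T : ℕ → ℕ} (hS : IsSPath n S) (hr : r < n)
    (hT : ∀ k, T k = if k ≤ r then 0 else S k) : IsSPath n T := by
  obtain ⟨h0, hn, hle, hmono⟩ := hS
  refine ⟨by simp [hT], by rw [hT, if_neg (by omega), hn], fun j hj => ?_, fun j hj => ?_⟩
  · have := hle j hj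
    rw [hT]
    split_ifs <;> omega
  · have := hmono j hj
    rw [hT, hT]
    split_ifs <;> omega

/-- Communication property of the path samplers: starting from any S-path `S`, the
sequence `S⁽⁰⁾ = S`, `S⁽ʳ⁾ = S⁽ʳ⁻¹⁾` with its `r`-th coordinate replaced by its
`(r-1)`-th coordinate (`r = 1, …, n-1`), consists of valid S-paths, each move assigns
a value in the admissible range `{S_{r-1}, …, min(r, S_{r+1})}`, and ends at the path
`(0, 0, …, 0, n)`. -/
theorem every_path_reaches_zero_path (n : ℕ) (hn : 2 ≤ n) (S : ℕ → ℕ)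
    (hS : IsSPath n S) (A : ℕ → ℕ → ℕ) (hA0 : A 0 = S)
    (hAstep : ∀ r, 1 ≤ r → r ≤ n - 1 →
      A r = Function.update (A (r - 1)) r (A (r - 1) (r - 1))) :
    (∀ r ≤ n - 1, IsSPath n (A r)) ∧
    (∀ r, 1 ≤ r → r ≤ n - 1 →
      A (r - 1) (r - 1) ≤ A (r - 1) (r - 1) ∧
      A (r - 1) (r - 1) ≤ min r (A (r - 1) (r + 1))) ∧
    (∀ k, 1 ≤ k → k ≤ n - 1 → A (n - 1) k = 0) ∧
    A (n - 1) 0 = 0 ∧ A (n - 1) n = n := by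
  have hA : ∀ r ≤ n - 1, ∀ k, A r k = if k ≤ r then 0 else S k := fun r hr =>
    sweep_apply_eq_ite hS.1 hA0 hAstep hr
  refine ⟨fun r hr => hS.of_eq_ite (by omega) (hA r hr), fun r h1 hr => ⟨le_rfl, ?_⟩,
    fun k _ hk => ?_, ?_, ?_⟩
  · simp [hA (r - 1) (by omega) (r - 1)]
  · rw [hA _ le_rfl, if_pos hk]
  · simp [hA _ le_rfl]
  · rw [hA _ le_rfl, if_neg (by omega), hS.2.1]
end
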